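/- Let q be a prime power, n ≥ 2 an integer, a, b ∈ F_q^*, and d := gcd(n, q − 1). Let P_n(a,b) be the number of monic irreducible polynomials of degree n over F_q whose coefficient of T^{n−1} equals −a and whose constant coefficient equals (−1)^n·b. Then |P_n(a,b) − (q^n − 1)/(n·q·(q − 1))| ≤ (1/n)·( (1 + (q − 2)·q^{(n−1)/2} − q^{(n−2)/2}·(q^{1/2} − 1)·(d − 1))/(q − 1) + 1/q ) + (q^{n/2} − 1)/(q(q − 1)) + (n/2)·q^{(n−4)/4}, the inequality being between real numbers with fractional powers of q taken as real powers. -/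

import Mathlib

section Characters

open Finset

variable {F K : Type*} [Field F] [Fintype F] [Field K] [Fintype K] [Algebra F K]

noncomputable instance MulChar.fintypeComplex : Fintype (MulChar F ℂ) := Fintype.ofFinite _

/-- Orthogonality of the multiplicative characters of a finite field. -/
theorem MulChar.sum_apply_eq_ite [DecidableEq F] (u : F) :
    ∑ χ : MulChar F ℂ, χ u = if u = 1 then (Fintype.card F : ℂ) - 1 else 0 := by
  split_ifs with hu
  · have h := MulChar.card_eq_card_units_of_hasEnoughRootsOfUnity F ℂ
    rw [Nat.card_eq_fintype_card, Nat.card_eq_fintype_card, Fintype.card_units] at h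
    simp [hu, h, Nat.cast_sub Fintype.card_pos]
  · obtain ⟨χ, hχ⟩ := MulChar.exists_apply_ne_one_of_hasEnoughRootsOfUnity F ℂ hu
    refine eq_zero_of_mul_eq_self_left hχ ?_
    simp only [Finset.mul_sum, ← MulChar.mul_apply]
    exact Fintype.sum_bijective _ (Group.mulLeft_bijective χ) _ _ fun χ' ↦ rfl

/-- A finite field with `q` elements has `gcd(n, q - 1)` complex multiplicative characters whose
`n`-th power is trivial. -/
theorem MulChar.card_pow_eq_one (n : ℕ) :
    #{χ : MulChar F ℂ | χ ^ n = 1} = Nat.gcd n (Fintype.card F - 1) := by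
  classical
  obtain ⟨e⟩ := MulChar.mulEquiv_units F ℂ
  have h := IsCyclic.card_powMonoidHom_ker (G := Fˣ) n
  rw [Nat.card_eq_fintype_card (α := Fˣ), Fintype.card_units, Nat.gcd_comm] at h
  rw [← h, ← Nat.card_congr (α := {χ : MulChar F ℂ // χ ^ n = 1}), Nat.card_eq_fintype_card,
    Fintype.card_subtype]
  refine e.toEquiv.subtypeEquiv fun χ ↦ ?_
  rw [MonoidHom.mem_ker]
  simp [← map_pow]

/-- The norm of a nontrivial Gauss sum over a finite field. -/
theorem norm_gaussSum_eq_sqrt_card {χ : MulChar F ℂ} (hχ : χ ≠ 1) {ψ : AddChar F ℂ} (hψ : ψ ≠ 1) :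
    ‖gaussSum χ ψ‖ = √(Fintype.card F) := by
  have h := gaussSum_mul_gaussSum_eq_card hχ (AddChar.IsPrimitive.of_ne_one hψ)
  rw [← star_gaussSum_eq, ← starRingEnd_apply, Complex.mul_conj'] at h
  rw [eq_comm, Real.sqrt_eq_iff_mul_self_eq (by positivity) (by positivity), ← sq]
  exact_mod_cast h.symm

/-- The multiplicative character `χ ∘ N` on an extension of finite fields. -/
noncomputable def MulChar.compNorm (K : Type*) [Field K] [Algebra F K] [Module.Finite F K]
    (χ : MulChar F ℂ) : MulChar K ℂ where
  toMonoidHom := χ.toMonoidHom.comp (Algebra.norm F)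
  map_nonunit' x hx := by
    have : x = 0 := by simpa using hx
    simp [this]

omit [Fintype K] in
theorem MulChar.compNorm_apply [Module.Finite F K] (χ : MulChar F ℂ) (x : K) :
    χ.compNorm K x = χ (Algebra.norm F x) := rfl

theorem MulChar.compNorm_eq_one_iff {χ : MulChar F ℂ} : χ.compNorm K = 1 ↔ χ = 1 := by
  constructor
  · intro h
    ext u
    obtain ⟨v, hv⟩ := FiniteField.unitsMap_norm_surjective F K u
    have := congrArg (fun η : MulChar K ℂ ↦ η v) h
    simp only [MulChar.compNorm_apply] at this
    rw [← hv, MulChar.one_apply_coe]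
    simpa using this
  · rintro rfl
    ext u
    simp [MulChar.compNorm_apply, MulChar.one_apply]

/-- The additive character `ψ ∘ Tr` on an extension of finite fields. -/
noncomputable def AddChar.compTrace (K : Type*) [Field K] [Algebra F K] (ψ : AddChar F ℂ) :
    AddChar K ℂ :=
  ψ.compAddMonoidHom (Algebra.trace F K).toAddMonoidHom

omit [Fintype F] [Fintype K] in
theorem AddChar.compTrace_apply (ψ : AddChar F ℂ) (x : K) :
    ψ.compTrace K x = ψ (Algebra.trace F K x) := rfl

theorem AddChar.compTrace_ne_one {ψ : AddChar F ℂ} (hψ : ψ ≠ 1) : ψ.compTrace K ≠ 1 := by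
  obtain ⟨y, hy⟩ := AddChar.ne_one_iff.1 hψ
  obtain ⟨x, rfl⟩ := Algebra.trace_surjective F K y
  exact AddChar.ne_one_iff.2 ⟨x, hy⟩

/-- The sum over `x` and `c` of `χ (N x) ψ (c (Tr x - a))` in terms of Gauss sums. -/
theorem sum_compNorm_mul_addChar (χ : MulChar F ℂ) (ψ : AddChar F ℂ) (a : F) :
    ∑ x : K, ∑ c : F, χ (Algebra.norm F x) * ψ (c * (Algebra.trace F K x - a)) =
      (if χ = 1 then (Fintype.card K : ℂ) - 1 else 0) +
        gaussSum (χ.compNorm K) (ψ.compTrace K) *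
          gaussSum (χ ^ Module.finrank F K)⁻¹ (ψ.mulShift (-a)) := by
  classical
  rw [Finset.sum_comm, ← Finset.add_sum_erase _ _ (mem_univ 0)]
  congr 1
  · have : ∑ x : K, χ.compNorm K x = if χ = 1 then (Fintype.card K : ℂ) - 1 else 0 := by
      split_ifs with h
      · rw [MulChar.compNorm_eq_one_iff.2 h, MulChar.sum_one_eq_card_units, Fintype.card_units,
          Nat.cast_sub Fintype.card_pos, Nat.cast_one]
      · exact MulChar.sum_eq_zero_of_ne_one (mt MulChar.compNorm_eq_one_iff.1 h)
    simpa [MulChar.compNorm_apply] using this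
  · rw [gaussSum.eq_1 (χ ^ _)⁻¹, Finset.mul_sum, ← Finset.add_sum_erase _ _ (mem_univ 0),
      MulChar.map_zero, zero_mul, mul_zero, zero_add]
    refine Finset.sum_congr rfl fun c hc ↦ ?_
    have hc0 : c ≠ 0 := (Finset.mem_erase.1 hc).1
    have hu : algebraMap F K c ≠ 0 := by simpa using hc0
    have key := gaussSum_mulShift_eq (χ.compNorm K) (ψ.compTrace K) (Units.mk0 _ hu)
    have h1 : (χ.compNorm K)⁻¹ (algebraMap F K c) = (χ ^ Module.finrank F K)⁻¹ c := by
      rw [MulChar.inv_apply', MulChar.inv_apply', ← map_inv₀, MulChar.compNorm_apply,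
        Algebra.norm_algebraMap, map_pow, MulChar.pow_apply' _ Module.finrank_pos.ne']
    rw [Units.val_mk0, h1] at key
    rw [← mul_assoc, mul_comm (gaussSum _ _), ← key, gaussSum, Finset.sum_mul]
    refine Finset.sum_congr rfl fun x _ ↦ ?_
    simp only [AddChar.mulShift_apply, AddChar.compTrace_apply, MulChar.compNorm_apply]
    rw [mul_assoc, ← AddChar.map_add_eq_mul, ← Algebra.smul_def, map_smul]
    congr 2
    simp; ring

/-- The number of elements of `K` of trace `a` and norm `b`, expressed through Gauss sums. -/
theorem card_trace_norm_mul_eq [DecidableEq F] {ψ : AddChar F ℂ} (hψ : ψ ≠ 1) (a : F) {b : F}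
    (hb : b ≠ 0) :
    (#{x : K | Algebra.trace F K x = a ∧ Algebra.norm F x = b} : ℂ) *
        (Fintype.card F * (Fintype.card F - 1)) - (Fintype.card K - 1) =
      ∑ χ : MulChar F ℂ, χ b⁻¹ * (gaussSum (χ.compNorm K) (ψ.compTrace K) *
          gaussSum (χ ^ Module.finrank F K)⁻¹ (ψ.mulShift (-a))) := by
  have h1 (x : K) : ∑ χ : MulChar F ℂ, χ b⁻¹ *
      ∑ c : F, χ (Algebra.norm F x) * ψ (c * (Algebra.trace F K x - a)) =
      if Algebra.trace F K x = a ∧ Algebra.norm F x = b then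
        (Fintype.card F * (Fintype.card F - 1) : ℂ) else 0 := by
    simp only [← Finset.mul_sum, ← mul_assoc, ← map_mul, ← Finset.sum_mul]
    rw [MulChar.sum_apply_eq_ite,
      AddChar.sum_mulShift _ (AddChar.IsPrimitive.of_ne_one hψ)]
    simp only [inv_mul_eq_one₀ hb, sub_eq_zero, eq_comm (a := b)]
    split_ifs <;> simp_all [mul_comm]
  have h2 : ∑ x : K, ∑ χ : MulChar F ℂ, χ b⁻¹ *
      ∑ c : F, χ (Algebra.norm F x) * ψ (c * (Algebra.trace F K x - a)) =
      (#{x : K | Algebra.trace F K x = a ∧ Algebra.norm F x = b} : ℂ) *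
        (Fintype.card F * (Fintype.card F - 1)) := by
    simp only [h1]
    rw [← Finset.sum_filter, Finset.sum_const, nsmul_eq_mul]
  rw [← h2, Finset.sum_comm, sub_eq_iff_eq_add']
  have h3 : (Fintype.card K : ℂ) - 1 =
      ∑ χ : MulChar F ℂ, χ b⁻¹ * if χ = 1 then (Fintype.card K : ℂ) - 1 else 0 := by
    simp [MulChar.one_apply, hb]
  rw [h3, ← Finset.sum_add_distrib]
  refine Finset.sum_congr rfl fun χ _ ↦ ?_
  rw [← Finset.mul_sum, sum_compNorm_mul_addChar, mul_add]

/-- The number of elements of `K` of nonzero trace `a` and nonzero norm `b` is close to its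
expected value. -/
theorem abs_card_trace_norm_sub_le [DecidableEq F] {a b : F} (ha : a ≠ 0) (hb : b ≠ 0) :
    |(#{x : K | Algebra.trace F K x = a ∧ Algebra.norm F x = b} : ℝ) *
        (Fintype.card F * (Fintype.card F - 1)) - ((Fintype.card F : ℝ) ^ Module.finrank F K - 1)|
      ≤ 1 + ((Module.finrank F K).gcd (Fintype.card F - 1) - 1) *
            √(Fintype.card F) ^ Module.finrank F K +
          (Fintype.card F - 1 - (Module.finrank F K).gcd (Fintype.card F - 1)) *
            √(Fintype.card F) ^ (Module.finrank F K + 1) := by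
  set n := Module.finrank F K with hn
  set s := √(Fintype.card F : ℝ) with hs
  obtain ⟨ψ, hψ'⟩ := AddChar.exists_apply_ne_zero.2 (one_ne_zero (α := F))
  have hψ : ψ ≠ 1 := AddChar.ne_one_iff.2 ⟨1, hψ'⟩
  have hcK : (Fintype.card K : ℝ) = (Fintype.card F : ℝ) ^ n := by
    exact_mod_cast Module.card_eq_pow_finrank (K := F) (V := K)
  have hsK : √(Fintype.card K) = s ^ n := by
    rw [hcK, hs, Real.sqrt_eq_rpow, Real.sqrt_eq_rpow, ← Real.rpow_natCast, ← Real.rpow_natCast,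
      ← Real.rpow_mul (by positivity), ← Real.rpow_mul (by positivity), mul_comm]
  have hs0 : 0 ≤ s := Real.sqrt_nonneg _
  have hψa : ψ.mulShift (-a) ≠ 1 := AddChar.IsPrimitive.of_ne_one hψ (by simpa using ha)
  let T (χ : MulChar F ℂ) : ℂ := χ b⁻¹ * (gaussSum (χ.compNorm K) (ψ.compTrace K) *
          gaussSum (χ ^ n)⁻¹ (ψ.mulShift (-a)))
  have hχb (χ : MulChar F ℂ) : ‖χ b⁻¹‖ = 1 :=
    Complex.norm_eq_one_of_mem_rootsOfUnity (χ.apply_mem_rootsOfUnity (Units.mk0 b hb)⁻¹)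
  have hT1 : ‖T 1‖ = 1 := by
    simp [T, hχb, MulChar.compNorm_eq_one_iff.2, gaussSum_one_left hψa,
      gaussSum_one_left (AddChar.compTrace_ne_one (K := K) hψ)]
  have hT (χ : MulChar F ℂ) (h : χ ≠ 1) : ‖T χ‖ = s ^ n * if χ ^ n = 1 then 1 else s := by
    simp only [T, norm_mul, hχb, one_mul]
    rw [norm_gaussSum_eq_sqrt_card (mt MulChar.compNorm_eq_one_iff.1 h)
      (AddChar.compTrace_ne_one hψ), hsK]
    split_ifs with h'
    · simp [h', gaussSum_one_left hψa]
    · rw [norm_gaussSum_eq_sqrt_card (by simpa using h') hψa]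
  have hsum : ∑ χ : MulChar F ℂ, ‖T χ‖ = 1 + (n.gcd (Fintype.card F - 1) - 1) * s ^ n +
      (Fintype.card F - 1 - n.gcd (Fintype.card F - 1)) * s ^ (n + 1) := by
    have hcard : (Fintype.card (MulChar F ℂ) : ℝ) = Fintype.card F - 1 := by
      have h := MulChar.card_eq_card_units_of_hasEnoughRootsOfUnity F ℂ
      rw [Nat.card_eq_fintype_card, Nat.card_eq_fintype_card, Fintype.card_units] at h
      simp [h, Nat.cast_sub Fintype.card_pos]
    have hsplit := Finset.sum_ite (s := univ) (p := fun χ : MulChar F ℂ ↦ χ ^ n = 1)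
      (fun _ ↦ (1 : ℝ)) (fun _ ↦ s)
    have hcompl := Finset.card_filter_add_card_filter_not (s := univ)
      (fun χ : MulChar F ℂ ↦ χ ^ n = 1)
    rw [Finset.card_univ, MulChar.card_pow_eq_one, ← @Nat.cast_inj ℝ, hcard, Nat.cast_add,
      ← eq_sub_iff_add_eq'] at hcompl
    rw [Finset.sum_const, Finset.sum_const, nsmul_eq_mul, nsmul_eq_mul, MulChar.card_pow_eq_one,
      hcompl, ← Finset.add_sum_erase _ _ (mem_univ 1), one_pow, if_pos rfl] at hsplit
    rw [← Finset.add_sum_erase _ _ (mem_univ 1), hT1,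
      Finset.sum_congr rfl fun χ hχ ↦ hT χ (Finset.ne_of_mem_erase hχ), ← Finset.mul_sum,
      eq_sub_of_add_eq' hsplit]
    ring
  have hkey := card_trace_norm_mul_eq (K := K) hψ a hb
  rw [← hsum]
  refine le_trans (le_of_eq ?_) (norm_sum_le _ _)
  rw [← hkey, ← hcK, ← Real.norm_eq_abs, ← Complex.norm_real]
  push_cast
  rfl

end Characters

section Counting

open Finset Polynomial IntermediateField

variable {F K : Type*} [Field F] [Field K] [Algebra F K] [FiniteDimensional F K]

/-- The trace of a generator of `K` is minus the second coefficient of its minimal polynomial. -/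
theorem Algebra.trace_eq_neg_coeff_minpoly {x : K}
    (hx : (minpoly F x).natDegree = Module.finrank F K) :
    Algebra.trace F K x = -(minpoly F x).coeff (Module.finrank F K - 1) := by
  have h1 : Module.finrank F⟮x⟯ K = 1 := by
    have h := Module.finrank_mul_finrank F F⟮x⟯ K
    rw [adjoin.finrank (Algebra.IsIntegral.isIntegral x), hx] at h
    exact Nat.eq_of_mul_eq_mul_left Module.finrank_pos (h.trans (mul_one _).symm)
  rw [trace_eq_finrank_mul_minpoly_nextCoeff, h1, Nat.cast_one, one_mul, nextCoeff_of_natDegree_pos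
    (hx ▸ Module.finrank_pos), hx]

/-- The norm of a generator of `K` is, up to sign, the constant coefficient of its minimal
polynomial. -/
theorem Algebra.norm_eq_coeff_minpoly {x : K}
    (hx : (minpoly F x).natDegree = Module.finrank F K) :
    Algebra.norm F x = (-1) ^ Module.finrank F K * (minpoly F x).coeff 0 := by
  have hint : IsIntegral F x := Algebra.IsIntegral.isIntegral x
  have h1 : Module.finrank F⟮x⟯ K = 1 := by
    have h := Module.finrank_mul_finrank F F⟮x⟯ K
    rw [adjoin.finrank hint, hx] at h
    exact Nat.eq_of_mul_eq_mul_left Module.finrank_pos (h.trans (mul_one _).symm)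
  have h2 := Algebra.PowerBasis.norm_gen_eq_coeff_zero_minpoly
    (IntermediateField.adjoin.powerBasis hint)
  rw [IntermediateField.adjoin.powerBasis_gen, IntermediateField.minpoly_gen,
    IntermediateField.adjoin.powerBasis_dim, hx] at h2
  rw [Algebra.norm_eq_norm_adjoin, h1, pow_one, h2]

omit [FiniteDimensional F K] in
/-- A monic irreducible polynomial of degree `[K : F]` is the minimal polynomial of exactly
`[K : F]` elements of `K`. -/
theorem card_filter_minpoly_eq [Fintype F] [Fintype K] [DecidableEq F[X]] {f : F[X]} (hm : f.Monic)
    (hi : Irreducible f) (hd : f.natDegree = Module.finrank F K) :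
    #{x : K | minpoly F x = f} = Module.finrank F K := by
  classical
  have hdvd := hi.natDegree_dvd_iff_dvd_X_pow_card_pow_sub_X.1 (dvd_of_eq hd)
  rw [Nat.card_eq_fintype_card, ← Module.card_eq_pow_finrank (K := F) (V := K)] at hdvd
  have h0 : (X ^ Fintype.card K - X : F[X]) ≠ 0 :=
    FiniteField.X_pow_card_sub_X_ne_zero _ Fintype.one_lt_card
  have hsp : (f.map (algebraMap F K)).Splits :=
    Splits.of_dvd (IsSplittingField.splits K (X ^ Fintype.card K - X : F[X]))
      (Polynomial.map_ne_zero h0) (Polynomial.map_dvd (algebraMap F K) hdvd)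
  have hc := card_rootSet_eq_natDegree (PerfectField.separable_of_irreducible hi) hsp
  rw [← hd, ← hc, ← Set.toFinset_card]
  congr 1
  ext x
  simp only [mem_filter, mem_univ, true_and, Set.mem_toFinset, mem_rootSet_of_ne hm.ne_zero]
  constructor
  · rintro rfl; exact minpoly.aeval F x
  · intro h; exact (minpoly.eq_of_irreducible_of_monic hi h hm).symm

/-- Counting the generators of `K` of given trace and norm by their minimal polynomials. -/
theorem finrank_mul_card_irreducible [Fintype F] [Fintype K] [DecidableEq F] (a b : F) :
    Module.finrank F K * Nat.card {f : F[X] // f.Monic ∧ Irreducible f ∧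
        f.natDegree = Module.finrank F K ∧ f.coeff (Module.finrank F K - 1) = -a ∧
        f.coeff 0 = (-1) ^ Module.finrank F K * b} =
      #{x : K | (minpoly F x).natDegree = Module.finrank F K ∧
        Algebra.trace F K x = a ∧ Algebra.norm F x = b} := by
  classical
  set n := Module.finrank F K with hn
  set S : Finset K := {x : K | (minpoly F x).natDegree = n ∧
        Algebra.trace F K x = a ∧ Algebra.norm F x = b} with hS
  have hsq : ((-1 : F) ^ n) * (-1) ^ n = 1 := by rw [← mul_pow]; simp
  have hset : {f : F[X] | f.Monic ∧ Irreducible f ∧ f.natDegree = n ∧ f.coeff (n - 1) = -a ∧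
        f.coeff 0 = (-1) ^ n * b} = (S.image (minpoly F) : Finset F[X]) := by
    ext f
    simp only [Set.mem_ofPred_eq, coe_image, Set.mem_image, mem_coe, hS, mem_filter, mem_univ,
      true_and]
    constructor
    · rintro ⟨hm, hi, hd, hta, hnb⟩
      have hne : (#{x : K | minpoly F x = f}) ≠ 0 := by
        rw [card_filter_minpoly_eq hm hi hd]; exact Module.finrank_pos.ne'
      obtain ⟨x, hx⟩ := Finset.card_ne_zero.1 hne
      obtain rfl : minpoly F x = f := by simpa using hx
      refine ⟨x, ⟨hd, ?_, ?_⟩, rfl⟩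
      · rw [Algebra.trace_eq_neg_coeff_minpoly hd, hta, neg_neg]
      · rw [Algebra.norm_eq_coeff_minpoly hd, hnb, ← mul_assoc, hsq, one_mul]
    · rintro ⟨x, ⟨hd, hta, hnb⟩, rfl⟩
      have hint : IsIntegral F x := Algebra.IsIntegral.isIntegral x
      refine ⟨minpoly.monic hint, minpoly.irreducible hint, hd, ?_, ?_⟩
      · rw [← hta, Algebra.trace_eq_neg_coeff_minpoly hd, neg_neg]
      · rw [← hnb, Algebra.norm_eq_coeff_minpoly hd, ← mul_assoc, hsq, one_mul]
  have hP : Nat.card {f : F[X] // f.Monic ∧ Irreducible f ∧ f.natDegree = n ∧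
      f.coeff (n - 1) = -a ∧ f.coeff 0 = (-1) ^ n * b} = #(S.image (minpoly F)) := by
    rw [← Set.ncard_coe_finset, ← hset]; rfl
  rw [hP, mul_comm, ← smul_eq_mul, ← Finset.sum_const,
    Finset.card_eq_sum_card_fiberwise (f := minpoly F) (t := S.image (minpoly F))
      fun x hx ↦ mem_coe.2 (mem_image_of_mem _ hx)]
  refine Finset.sum_congr rfl fun f hf ↦ ?_
  obtain ⟨hm, hi, hd, hta, hnb⟩ := hset.ge hf
  rw [hn, ← card_filter_minpoly_eq hm hi hd]
  congr 1
  ext x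
  simp only [hS, mem_filter, mem_univ, true_and]
  obtain ⟨y, hy, rfl⟩ := Finset.mem_image.1 hf
  refine ⟨fun hx ↦ ⟨?_, hx⟩, fun hx ↦ hx.2⟩
  rw [hx]
  refine ⟨hd, ?_, ?_⟩
  · rw [Algebra.trace_eq_neg_coeff_minpoly (hx ▸ hd), hx, hta, neg_neg]
  · rw [Algebra.norm_eq_coeff_minpoly (hx ▸ hd), hx, hnb, ← mul_assoc, hsq, one_mul]

end Counting

section Subfields

open Finset Polynomial

variable {F K : Type*} [Field F] [Field K]

/-- The additive polynomial `∑ X ^ (q ^ i)` takes each value at most `q ^ m` times. -/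
theorem card_sum_pow_pow_eq_le [Fintype K] [DecidableEq K] {q : ℕ} (hq : 2 ≤ q) (m : ℕ) (t : K) :
    #{x : K | ∑ i ∈ range (m + 1), x ^ q ^ i = t} ≤ q ^ m := by
  set f : K[X] := ∑ i ∈ range (m + 1), X ^ q ^ i - C t with hf
  have hf0 : f ≠ 0 := by
    intro h
    have h1 : f.coeff 1 = 1 := by
      simp only [hf, coeff_sub, finsetSum_coeff, coeff_X_pow, coeff_C_succ, sub_zero]
      rw [Finset.sum_eq_single 0]
      · simp
      · intro i _ hi
        exact if_neg (Nat.one_lt_pow hi (by lia)).ne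
      · simp
    simp [h] at h1
  have hdeg : f.natDegree ≤ q ^ m := by
    refine (natDegree_sub_le_of_le (n := 0) (natDegree_sum_le_of_forall_le _ _ fun i hi ↦ ?_)
      (natDegree_C t).le).trans (max_le le_rfl (Nat.zero_le _))
    rw [natDegree_X_pow]
    exact Nat.pow_le_pow_right (by lia) (Nat.lt_succ_iff.1 (mem_range.1 hi))
  refine (card_le_degree_of_subset_roots (p := f) fun x hx ↦ ?_).trans hdeg
  simp only [mem_val, mem_filter, mem_univ, true_and] at hx
  rw [mem_roots hf0, IsRoot.def]
  simp [hf, eval_finsetSum, hx]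

/-- The additive and the multiplicative polynomials `∑ X ^ (q ^ i)` and `∏ X ^ (q ^ i)` take each
pair of values only a bounded number of times. -/
theorem card_sum_pow_pow_eq_prod_pow_pow_eq_le [Fintype K] [DecidableEq K] {q : ℕ} (hq : 2 ≤ q)
    (m : ℕ) (t : K) {c : K} (hc : c ≠ 0) :
    #{x : K | ∑ i ∈ range (m + 2), x ^ q ^ i = t ∧ ∏ i ∈ range (m + 2), x ^ q ^ i = c} ≤
      ∑ i ∈ range (m + 1), q ^ i + q ^ m := by
  set f : K[X] := (X ^ ∑ i ∈ range (m + 1), q ^ i) * (C t - ∑ i ∈ range (m + 1), X ^ q ^ i) - C c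
    with hf
  have hf0 : f ≠ 0 := by
    intro h
    have h1 : f.coeff 0 = -c := by
      rw [hf, Finset.sum_range_succ']
      simp [mul_coeff_zero, coeff_X_pow]
    simp [h, eq_comm, hc] at h1
  have hdeg : f.natDegree ≤ ∑ i ∈ range (m + 1), q ^ i + q ^ m := by
    refine (natDegree_sub_le_of_le (n := 0) (natDegree_mul_le_of_le (natDegree_X_pow _).le
      (natDegree_sub_le_of_le (m := 0) (natDegree_C t).le
        (natDegree_sum_le_of_forall_le (n := q ^ m) _ _ fun i hi ↦ ?_)))
      (natDegree_C c).le).trans (by simp)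
    rw [natDegree_X_pow]
    exact Nat.pow_le_pow_right (by lia) (Nat.lt_succ_iff.1 (mem_range.1 hi))
  refine (card_le_degree_of_subset_roots (p := f) fun x hx ↦ ?_).trans hdeg
  simp only [mem_val, mem_filter, mem_univ, true_and] at hx
  rw [mem_roots hf0, IsRoot.def]
  rw [Finset.sum_range_succ, Finset.prod_range_succ, Finset.prod_pow_eq_pow_sum] at hx
  simp only [hf, eval_sub, eval_mul, eval_pow, eval_X, eval_C, eval_finsetSum]
  rw [← hx.1, add_sub_cancel_left, hx.2, sub_self]

/-- The Frobenius powers of an element fixed by `x ↦ x ^ (q ^ m)` are periodic. -/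
theorem pow_pow_add_mul_eq {x : K} {q m : ℕ} (hx : x ^ q ^ m = x) (i j : ℕ) :
    x ^ q ^ (m * j + i) = x ^ q ^ i := by
  induction j with
  | zero => simp
  | succ j ih => rw [mul_add, mul_one, add_comm (m * j), add_assoc, pow_add, pow_mul, hx, ih]

theorem sum_range_mul_pow_pow {x : K} {q m : ℕ} (hx : x ^ q ^ m = x) (l : ℕ) :
    ∑ i ∈ range (m * l), x ^ q ^ i = l * ∑ i ∈ range m, x ^ q ^ i := by
  induction l with
  | zero => simp
  | succ l ih =>
    rw [mul_add, mul_one, Finset.sum_range_add, ih]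
    simp only [pow_pow_add_mul_eq hx]
    push_cast
    ring

theorem prod_range_mul_pow_pow {x : K} {q m : ℕ} (hx : x ^ q ^ m = x) (l : ℕ) :
    ∏ i ∈ range (m * l), x ^ q ^ i = (∏ i ∈ range m, x ^ q ^ i) ^ l := by
  induction l with
  | zero => simp
  | succ l ih =>
    rw [mul_add, mul_one, Finset.prod_range_add, ih]
    simp only [pow_pow_add_mul_eq hx]
    ring

variable [Fintype F] [Algebra F K]

/-- An element of `K` that does not generate `K` over `F` lies in a maximal proper subfield. -/
theorem exists_primeFactor_pow_eq_self [FiniteDimensional F K] {x : K}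
    (hx : (minpoly F x).natDegree ≠ Module.finrank F K) :
    ∃ l ∈ (Module.finrank F K).primeFactors,
      x ^ Fintype.card F ^ (Module.finrank F K / l) = x := by
  have hint : IsIntegral F x := Algebra.IsIntegral.isIntegral x
  obtain ⟨j, hj⟩ : (minpoly F x).natDegree ∣ Module.finrank F K := minpoly.degree_dvd hint
  have hn : Module.finrank F K ≠ 0 := Module.finrank_pos.ne'
  obtain ⟨l, hl, k, rfl⟩ := Nat.exists_prime_and_dvd (n := j) (by rintro rfl; simp [hj] at hx)
  refine ⟨l, Nat.mem_primeFactors.2 ⟨hl, ⟨(minpoly F x).natDegree * k, by rw [hj]; ring⟩, hn⟩, ?_⟩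
  have h1 : Module.finrank F K / l = (minpoly F x).natDegree * k := by
    rw [hj]
    exact Nat.div_eq_of_eq_mul_right hl.pos (by ring)
  have h2 := (minpoly.irreducible hint).natDegree_dvd_iff_dvd_X_pow_card_pow_sub_X.1
    (Dvd.intro k h1.symm)
  have h3 := (minpoly.dvd_iff (A := F) (x := x)).1 h2
  simpa [sub_eq_zero] using h3

variable [Fintype K]

/-- The trace and the norm of an element of the subfield of index `l`. -/
theorem algebraMap_trace_norm_of_pow_eq_self {l : ℕ} (hl : l ∣ Module.finrank F K) {x : K}
    (hx : x ^ Fintype.card F ^ (Module.finrank F K / l) = x) :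
    algebraMap F K (Algebra.trace F K x) =
        l * ∑ i ∈ range (Module.finrank F K / l), x ^ Fintype.card F ^ i ∧
      algebraMap F K (Algebra.norm F x) =
        (∏ i ∈ range (Module.finrank F K / l), x ^ Fintype.card F ^ i) ^ l := by
  rw [FiniteField.algebraMap_trace_eq_sum_pow, FiniteField.algebraMap_norm_eq_prod_pow,
    Nat.card_eq_fintype_card, ← sum_range_mul_pow_pow hx, ← prod_range_mul_pow_pow hx,
    Nat.div_mul_cancel hl]
  exact ⟨rfl, rfl⟩

variable [DecidableEq F] [DecidableEq K]

theorem card_trace_norm_subfield_le {l : ℕ} (hl : l ∣ Module.finrank F K) {a : F} (ha : a ≠ 0)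
    (b : F) :
    #{x : K | x ^ Fintype.card F ^ (Module.finrank F K / l) = x ∧
      Algebra.trace F K x = a ∧ Algebra.norm F x = b} ≤
        Fintype.card F ^ (Module.finrank F K / l - 1) := by
  obtain ⟨m, hm⟩ : ∃ m, Module.finrank F K / l = m + 1 :=
    Nat.exists_eq_succ_of_ne_zero
      (Nat.div_pos (Nat.le_of_dvd Module.finrank_pos hl) (Nat.pos_of_dvd_of_pos hl
        Module.finrank_pos)).ne'
  have ha' : algebraMap F K a ≠ 0 := by simpa using ha
  refine (Finset.card_le_card fun x hx ↦ ?_).trans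
    (card_sum_pow_pow_eq_le Fintype.one_lt_card (Module.finrank F K / l - 1)
      (algebraMap F K a / l))
  obtain ⟨hxl, hta, -⟩ := by simpa using hx
  have h := (algebraMap_trace_norm_of_pow_eq_self hl hxl).1
  have hl0 : (l : K) ≠ 0 := by
    intro h0
    rw [h0, zero_mul, hta] at h
    exact ha' h
  rw [mem_filter, hm, Nat.add_sub_cancel, ← hm, ← hta, h, mul_div_cancel_left₀ _ hl0]
  exact ⟨mem_univ _, rfl⟩

theorem card_trace_norm_subfield_two_le (hl : 2 ∣ Module.finrank F K)
    (hn : 4 ≤ Module.finrank F K) {a b : F} (ha : a ≠ 0) (hb : b ≠ 0) :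
    #{x : K | x ^ Fintype.card F ^ (Module.finrank F K / 2) = x ∧
      Algebra.trace F K x = a ∧ Algebra.norm F x = b} ≤
        (if Module.finrank F K = 4 then 4 else 5) *
          Fintype.card F ^ (Module.finrank F K / 2 - 2) := by
  obtain ⟨m, hm⟩ : ∃ m, Module.finrank F K / 2 = m + 2 := ⟨Module.finrank F K / 2 - 2, by lia⟩
  have ha' : algebraMap F K a ≠ 0 := by simpa using ha
  have hb' : algebraMap F K b ≠ 0 := by simpa using hb
  rcases Finset.eq_empty_or_nonempty {x : K | x ^ Fintype.card F ^ (Module.finrank F K / 2) = x ∧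
      Algebra.trace F K x = a ∧ Algebra.norm F x = b} with he | ⟨x₀, hx₀⟩
  · rw [he]; simp
  obtain ⟨h₀, hta₀, -⟩ := by simpa using hx₀
  have h20 : (2 : K) ≠ 0 := by
    intro h0
    have h := (algebraMap_trace_norm_of_pow_eq_self hl h₀).1
    rw [hta₀, Nat.cast_ofNat, h0, zero_mul] at h
    exact ha' h
  have hq : 3 ≤ Fintype.card F := by
    refine lt_of_le_of_ne (Nat.succ_le_of_lt Fintype.one_lt_card) fun h ↦ h20 ?_
    have h2 := congrArg (algebraMap F K) (FiniteField.cast_card_eq_zero F)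
    rwa [← h, map_natCast, map_zero] at h2
  have hsub : ({x : K | x ^ Fintype.card F ^ (Module.finrank F K / 2) = x ∧
      Algebra.trace F K x = a ∧ Algebra.norm F x = b} : Finset K) ⊆
      (nthRootsFinset 2 (algebraMap F K b)).biUnion fun c ↦
        {x : K | ∑ i ∈ range (m + 2), x ^ Fintype.card F ^ i = algebraMap F K a / 2 ∧
          ∏ i ∈ range (m + 2), x ^ Fintype.card F ^ i = c} := by
    intro x hx
    obtain ⟨hxl, hta, hnb⟩ := by simpa using hx
    obtain ⟨h1, h2⟩ := algebraMap_trace_norm_of_pow_eq_self hl hxl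
    rw [hta, Nat.cast_ofNat, hm] at h1
    rw [hnb, hm] at h2
    simp only [mem_biUnion, mem_filter, mem_univ, true_and]
    exact ⟨_, (mem_nthRootsFinset two_pos _).2 h2.symm, by
      rw [h1, mul_div_cancel_left₀ _ h20], rfl⟩
  have hcard : #(nthRootsFinset 2 (algebraMap F K b)) ≤ 2 := by
    rw [nthRootsFinset_def]
    exact (Multiset.toFinset_card_le _).trans (card_nthRoots _ _)
  have hgeom (k : ℕ) : 2 * ∑ i ∈ range (k + 1), Fintype.card F ^ i ≤ 3 * Fintype.card F ^ k := by
    induction k with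
    | zero => simp
    | succ k ih =>
      rw [Finset.sum_range_succ, pow_succ]
      nlinarith [Nat.pos_of_ne_zero (pow_ne_zero k (by lia : Fintype.card F ≠ 0))]
  refine (Finset.card_le_card hsub).trans ((Finset.card_biUnion_le_card_mul _ _ _ fun c hc ↦
    card_sum_pow_pow_eq_prod_pow_pow_eq_le (by lia) m _ ?_).trans
      ((Nat.mul_le_mul_right _ hcard).trans ?_))
  · rintro rfl
    exact hb' (by simpa using ((mem_nthRootsFinset two_pos _).1 hc).symm)
  · rw [hm, Nat.add_sub_cancel]
    split_ifs with h4
    · obtain rfl : m = 0 := by lia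
      simp
    · linarith [hgeom m]

/-- The number of elements of trace `a` and norm `b` in proper subfields is small. -/
theorem card_trace_norm_not_generator_le (hn : 4 ≤ Module.finrank F K) {a b : F} (ha : a ≠ 0)
    (hb : b ≠ 0) :
    (#{x : K | (minpoly F x).natDegree ≠ Module.finrank F K ∧
      Algebra.trace F K x = a ∧ Algebra.norm F x = b} : ℝ) ≤
        Module.finrank F K * √(Fintype.card F) ^ (Module.finrank F K - 4) := by
  set n := Module.finrank F K with hn'
  set s := √(Fintype.card F : ℝ) with hs
  have hs1 : 1 ≤ s := by
    rw [hs, Real.one_le_sqrt]; exact_mod_cast Fintype.card_pos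
  have hsq (k : ℕ) : (Fintype.card F : ℝ) ^ k = s ^ (2 * k) := by
    rw [pow_mul, Real.sq_sqrt (Nat.cast_nonneg _)]
  let w (l : ℕ) : ℕ := if l = 2 then if n = 4 then 4 else 5 else 1
  have hw : ∑ l ∈ n.primeFactors, w l ≤ n := by
    have herase : ∑ l ∈ n.primeFactors.erase 2, w l = #(n.primeFactors.erase 2) := by
      rw [Finset.card_eq_sum_ones]
      exact Finset.sum_congr rfl fun l hl ↦ if_neg (Finset.ne_of_mem_erase hl)
    by_cases h2 : 2 ∣ n
    · rw [← Finset.add_sum_erase _ _ (Nat.mem_primeFactors.2 ⟨Nat.prime_two, h2, by lia⟩), herase]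
      have hle : #(n.primeFactors.erase 2) ≤ #(Icc 3 (n / 2)) := by
        refine Finset.card_le_card fun l hl ↦ ?_
        obtain ⟨hl2, hl⟩ := Finset.mem_erase.1 hl
        obtain ⟨hp, hd, -⟩ := Nat.mem_primeFactors.1 hl
        have := Nat.le_of_dvd (by lia) (Nat.Coprime.mul_dvd_of_dvd_of_dvd
          ((Nat.coprime_primes hp Nat.prime_two).2 hl2) hd h2)
        have := hp.two_le
        rw [Finset.mem_Icc]
        lia
      rw [Nat.card_Icc] at hle
      simp only [w, if_true]
      split_ifs <;> lia
    · have h2' : 2 ∉ n.primeFactors := fun h ↦ h2 (Nat.dvd_of_mem_primeFactors h)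
      rw [← Finset.erase_eq_of_notMem h2', herase]
      refine (Finset.card_le_card (t := Icc 1 n) fun l hl ↦ ?_).trans (by simp)
      have hl := Finset.mem_of_mem_erase hl
      exact Finset.mem_Icc.2 ⟨Nat.pos_of_mem_primeFactors hl, Nat.le_of_mem_primeFactors hl⟩
  have hS (l : ℕ) (hl : l ∈ n.primeFactors) :
      (#{x : K | x ^ Fintype.card F ^ (n / l) = x ∧
        Algebra.trace F K x = a ∧ Algebra.norm F x = b} : ℝ) ≤ w l * s ^ (n - 4) := by
    obtain ⟨hp, hd, -⟩ := Nat.mem_primeFactors.1 hl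
    by_cases hl2 : l = 2
    · subst hl2
      have h := card_trace_norm_subfield_two_le (K := K) hd hn ha hb
      rw [← @Nat.cast_le ℝ, Nat.cast_mul, Nat.cast_pow, hsq] at h
      have he : n - 4 = 2 * (Module.finrank F K / 2 - 2) := by lia
      rw [he]
      exact h
    · have h := card_trace_norm_subfield_le (K := K) hd ha b
      rw [← @Nat.cast_le ℝ, Nat.cast_pow, hsq] at h
      refine h.trans ?_
      simp only [w, if_neg hl2, Nat.cast_one, one_mul]
      refine pow_le_pow_right₀ hs1 ?_
      obtain ⟨k, hk⟩ := hd
      rw [← hn', hk, Nat.mul_div_cancel_left _ hp.pos]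
      have h3 : 3 ≤ l := lt_of_le_of_ne hp.two_le (Ne.symm hl2)
      rcases k with _ | _ | k
      · lia
      · lia
      · have : 3 * (k + 1 + 1) ≤ l * (k + 1 + 1) := Nat.mul_le_mul_right _ h3
        lia
  have hsub : ({x : K | (minpoly F x).natDegree ≠ n ∧
      Algebra.trace F K x = a ∧ Algebra.norm F x = b} : Finset K) ⊆
      n.primeFactors.biUnion fun l ↦ {x : K | x ^ Fintype.card F ^ (n / l) = x ∧
        Algebra.trace F K x = a ∧ Algebra.norm F x = b} := by
    intro x hx
    obtain ⟨hd, hta, hnb⟩ := by simpa using hx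
    obtain ⟨l, hl, hxl⟩ := exists_primeFactor_pow_eq_self hd
    simp only [mem_biUnion, mem_filter, mem_univ, true_and]
    exact ⟨l, hl, hxl, hta, hnb⟩
  calc _ ≤ ((∑ l ∈ n.primeFactors, #{x : K | x ^ Fintype.card F ^ (n / l) = x ∧
        Algebra.trace F K x = a ∧ Algebra.norm F x = b} : ℕ) : ℝ) :=
        Nat.cast_le.2 ((Finset.card_le_card hsub).trans Finset.card_biUnion_le)
    _ ≤ ∑ l ∈ n.primeFactors, w l * s ^ (n - 4) := by
        rw [Nat.cast_sum]; exact Finset.sum_le_sum hS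
    _ ≤ n * s ^ (n - 4) := by
        rw [← Finset.sum_mul]
        gcongr
        exact_mod_cast hw

end Subfields

section LowDegree

open Polynomial Finset

variable {F : Type*} [Field F]

/-- A monic polynomial of degree `m + 1` is determined by its first `m + 1` coefficients. -/
theorem Polynomial.Monic.eq_of_coeff_eq {m : ℕ} {f g : F[X]} (hf : f.Monic) (hg : g.Monic)
    (hfm : f.natDegree = m) (hgm : g.natDegree = m) (h : ∀ i < m, f.coeff i = g.coeff i) :
    f = g := by
  ext i
  rcases lt_trichotomy i m with hi | rfl | hi
  · exact h i hi
  · have h1 := hf.coeff_natDegree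
    have h2 := hg.coeff_natDegree
    rw [hfm] at h1
    rw [hgm] at h2
    rw [h1, h2]
  · rw [coeff_eq_zero_of_natDegree_lt (hfm ▸ hi), coeff_eq_zero_of_natDegree_lt (hgm ▸ hi)]

/-- A monic quadratic polynomial is determined by its trace and norm. -/
theorem card_irreducible_quadratic_le_one (a b : F) :
    Nat.card {f : F[X] // f.Monic ∧ Irreducible f ∧ f.natDegree = 2 ∧
      f.coeff 1 = a ∧ f.coeff 0 = b} ≤ 1 := by
  have : Subsingleton {f : F[X] // f.Monic ∧ Irreducible f ∧ f.natDegree = 2 ∧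
      f.coeff 1 = a ∧ f.coeff 0 = b} := by
    refine ⟨fun ⟨f, hf, _, hf2, hf1, hf0⟩ ⟨g, hg, _, hg2, hg1, hg0⟩ ↦ Subtype.ext ?_⟩
    refine hf.eq_of_coeff_eq hg hf2 hg2 fun i hi ↦ ?_
    interval_cases i
    · exact hf0.trans hg0.symm
    · exact hf1.trans hg1.symm
  exact Finite.card_le_one_iff_subsingleton.2 this

/-- At least two of the cubics `X ^ 3 - 3 r X ^ 2 + c X - r ^ 3` are irreducible. -/
theorem two_le_card_irreducible_cubic [Fintype F] (hq : 6 ≤ Fintype.card F) {r : F} (hr : r ≠ 0) :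
    2 ≤ Nat.card {f : F[X] // f.Monic ∧ Irreducible f ∧ f.natDegree = 3 ∧
      f.coeff 2 = -(3 * r) ∧ f.coeff 0 = -r ^ 3} := by
  classical
  let f (c : F) : F[X] := X ^ 3 + C (-(3 * r)) * X ^ 2 + C c * X + C (-r ^ 3)
  have hf (c : F) : (f c).natDegree = 3 := by simp only [f]; compute_degree!
  have hfm (c : F) : (f c).Monic := by simp only [f]; monicity!
  have hf2 (c : F) : (f c).coeff 2 = -(3 * r) := by simp [f, -map_neg, -map_mul]
  have hf1 (c : F) : (f c).coeff 1 = c := by simp [f, coeff_C, coeff_X_pow, -map_neg]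
  have hf0 (c : F) : (f c).coeff 0 = -r ^ 3 := by simp [f, -map_neg]
  let g (y : F) : F := (r ^ 3 + 3 * r * y ^ 2 - y ^ 3) / y
  obtain ⟨k, hk⟩ : ∃ k : F, k ≠ 0 ∧ k + 1 ≠ 0 ∧ k ^ 3 - 1 ≠ 0 := by
    have hm : (X * (X + C 1) * (X ^ 3 - C 1) : F[X]).Monic := by monicity!
    obtain ⟨k, hk⟩ := exists_eval_ne_zero_of_natDegree_lt_card _ hm.ne_zero (by
      have : (X * (X + C 1) * (X ^ 3 - C 1) : F[X]).natDegree ≤ 5 := by compute_degree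
      rw [Cardinal.mk_fintype]
      exact_mod_cast this.trans_lt hq)
    refine ⟨k, ?_⟩
    simpa [and_assoc] using hk
  obtain ⟨hk0, hk1, hk3⟩ := hk
  set y₁ : F := -r / (k * (k + 1)) with hy₁
  set y₂ : F := -r * k ^ 2 / (k + 1) with hy₂
  have hy₁0 : y₁ ≠ 0 := by simp [hy₁, hr, hk0, hk1]
  have hy₂0 : y₂ ≠ 0 := by simp [hy₂, hr, hk0, hk1]
  have hne : y₂ ≠ y₁ := by
    intro h
    rw [hy₁, hy₂] at h
    field_simp at h
    apply hk3
    linear_combination -h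
  have hg : g y₂ = g y₁ := by
    simp only [g, hy₁, hy₂]
    field_simp
    ring
  have hred : ({c : F | ¬ Irreducible (f c)} : Finset F) ⊆ ((univ.erase 0).erase y₁).image g := by
    intro c hc
    have hc := (mem_filter.1 hc).2
    rw [(hfm c).irreducible_iff_roots_eq_zero_of_degree_le_three (by rw [hf]; lia) (hf c).le] at hc
    obtain ⟨y, hy⟩ := Multiset.exists_mem_of_ne_zero hc
    have hy := isRoot_of_mem_roots hy
    simp only [f, IsRoot.def, eval_add, eval_mul, eval_pow, eval_X, eval_C] at hy
    have hy0 : y ≠ 0 := by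
      rintro rfl
      simp [hr] at hy
    have hcg : g y = c := by
      simp only [g]
      rw [div_eq_iff hy0]
      linear_combination -hy
    by_cases hyy : y = y₁
    · exact mem_image.2 ⟨y₂, by simp [hne, hy₂0], by rw [hg, ← hyy, hcg]⟩
    · exact mem_image.2 ⟨y, by simp [hyy, hy0], hcg⟩
  have hcard : #{c : F | ¬ Irreducible (f c)} ≤ Fintype.card F - 2 := by
    refine ((card_le_card hred).trans card_image_le).trans ?_
    rw [card_erase_of_mem (by simp [hy₁0]), card_erase_of_mem (mem_univ _), card_univ]
    lia
  have htot := card_filter_add_card_filter_not (s := (univ : Finset F)) fun c ↦ Irreducible (f c)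
  rw [card_univ] at htot
  have hfin : Finite {f : F[X] // f.Monic ∧ Irreducible f ∧ f.natDegree = 3 ∧
      f.coeff 2 = -(3 * r) ∧ f.coeff 0 = -r ^ 3} := by
    refine Finite.of_injective (fun p (i : Fin 3) ↦ p.1.coeff i) fun ⟨p, hp⟩ ⟨p', hp'⟩ h ↦
      Subtype.ext (hp.1.eq_of_coeff_eq hp'.1 hp.2.2.1 hp'.2.2.1 fun i hi ↦ congrFun h ⟨i, hi⟩)
  have hle := Nat.card_le_card_of_injective
    (fun c : {c : F // Irreducible (f c)} ↦ (⟨f c, hfm _, c.2, hf _, hf2 _, hf0 _⟩ :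
      {f : F[X] // f.Monic ∧ Irreducible f ∧ f.natDegree = 3 ∧
        f.coeff 2 = -(3 * r) ∧ f.coeff 0 = -r ^ 3})) fun c c' h ↦ by
      have h := congrArg (fun p ↦ p.1.coeff 1) h
      simp only [hf1] at h
      exact Subtype.ext h
  rw [Nat.card_eq_fintype_card, Fintype.card_subtype] at hle
  lia

end LowDegree

section Estimate

open Polynomial Finset

variable {F K : Type*} [Field F] [Fintype F] [Field K] [Algebra F K] [Fintype K]

theorem card_trace_norm_not_generator_le_one [DecidableEq F] (hn : Module.finrank F K = 3) {a : F}
    (ha : a ≠ 0) (b : F) :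
    #{x : K | (minpoly F x).natDegree ≠ Module.finrank F K ∧
      Algebra.trace F K x = a ∧ Algebra.norm F x = b} ≤ 1 := by
  classical
  have h := card_trace_norm_subfield_le (K := K) (l := 3) (by rw [hn]) ha b
  rw [hn] at h
  refine (card_le_card fun x hx ↦ ?_).trans h
  obtain ⟨hd, hx⟩ := (mem_filter.1 hx).2
  obtain ⟨l, hl, hxl⟩ := exists_primeFactor_pow_eq_self hd
  rw [hn, Nat.prime_three.primeFactors, mem_singleton] at hl
  rw [hn, hl] at hxl
  exact mem_filter.2 ⟨mem_univ _, hxl, hx⟩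

/-- If an element of a cubic extension with trace `a ≠ 0` and norm `b` does not generate it, then
there are at least two irreducible cubic polynomials with trace `a` and norm `b`. -/
theorem two_le_card_irreducible_of_not_generator (hq : 6 ≤ Fintype.card F)
    (hn : Module.finrank F K = 3) {x : K} (hd : (minpoly F x).natDegree ≠ Module.finrank F K)
    (ha : Algebra.trace F K x ≠ 0) :
    2 ≤ Nat.card {f : F[X] // f.Monic ∧ Irreducible f ∧ f.natDegree = 3 ∧
      f.coeff 2 = -Algebra.trace F K x ∧ f.coeff 0 = -Algebra.norm F x} := by
  obtain ⟨l, hl, hxl⟩ := exists_primeFactor_pow_eq_self hd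
  rw [hn, Nat.prime_three.primeFactors, mem_singleton] at hl
  subst hl
  obtain ⟨h1, h2⟩ := algebraMap_trace_norm_of_pow_eq_self (by rw [hn]) hxl
  simp only [hn, Nat.div_self, Nat.ofNat_pos, range_one, sum_singleton, prod_singleton, pow_zero,
    pow_one, Nat.cast_ofNat] at h1 h2
  have h3 : (3 : F) ≠ 0 := by
    intro h3
    have h3 := congrArg (algebraMap F K) h3
    rw [map_ofNat, map_zero] at h3
    rw [h3, zero_mul, map_eq_zero] at h1
    exact ha h1
  set r := Algebra.trace F K x / 3 with hr
  have hta : Algebra.trace F K x = 3 * r := by rw [hr]; field_simp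
  have hrx : algebraMap F K r = x := by
    have h3' : (3 : K) ≠ 0 := by
      have := (map_ne_zero (algebraMap F K)).2 h3
      rwa [map_ofNat] at this
    rw [hta, map_mul, map_ofNat] at h1
    exact mul_left_cancel₀ h3' h1
  have hnb : Algebra.norm F x = r ^ 3 := by
    rw [← hrx, ← map_pow] at h2
    rw [← hrx]
    exact (algebraMap F K).injective h2
  have hr0 : r ≠ 0 := by
    rintro h
    rw [h, mul_zero] at hta
    exact ha hta
  rw [hta, hnb]
  exact two_le_card_irreducible_cubic hq hr0

/-- The estimate for the number of irreducible polynomials with prescribed trace and norm, cleared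
of denominators. -/
theorem abs_card_irreducible_sub_le {n : ℕ} (hn : 2 ≤ n) (hK : Module.finrank F K = n) {a b : F}
    (ha : a ≠ 0) (hb : b ≠ 0) {w : ℝ} (hw : 0 ≤ w) (hw3 : n = 3 → Fintype.card F ≤ 5 → 2 / 9 ≤ w) :
    |(n * Nat.card {f : F[X] // f.Monic ∧ Irreducible f ∧ f.natDegree = n ∧
        f.coeff (n - 1) = -a ∧ f.coeff 0 = (-1) ^ n * b} : ℝ) *
        (Fintype.card F * (Fintype.card F - 1)) - ((Fintype.card F : ℝ) ^ n - 1)| ≤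
      (2 * Fintype.card F - 1) + (n.gcd (Fintype.card F - 1) - 1) * √(Fintype.card F) ^ n +
        (Fintype.card F - 1 - n.gcd (Fintype.card F - 1)) * √(Fintype.card F) ^ (n + 1) +
        n * (√(Fintype.card F) ^ n - 1) +
        n ^ 2 / 2 * w * (Fintype.card F * (Fintype.card F - 1)) := by
  classical
  have hgauss := abs_card_trace_norm_sub_le (K := K) ha hb
  have hcount := finrank_mul_card_irreducible (K := K) a b
  have hsplit := card_filter_add_card_filter_not
    (s := ({x : K | Algebra.trace F K x = a ∧ Algebra.norm F x = b} : Finset K))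
    fun x ↦ (minpoly F x).natDegree = Module.finrank F K
  simp only [filter_filter, and_comm (b := _ = Module.finrank F K),
    and_comm (b := ¬ _ = Module.finrank F K)] at hsplit
  rw [← hcount] at hsplit
  have hlarge := fun h ↦ card_trace_norm_not_generator_le (K := K) h ha hb
  have hcubic := fun h ↦ card_trace_norm_not_generator_le_one (K := K) h ha b
  have htwo (hq : 6 ≤ Fintype.card F) (h3 : n = 3)
      (h : #{x : K | (minpoly F x).natDegree ≠ Module.finrank F K ∧
        Algebra.trace F K x = a ∧ Algebra.norm F x = b} ≠ 0) :
      2 ≤ Nat.card {f : F[X] // f.Monic ∧ Irreducible f ∧ f.natDegree = n ∧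
        f.coeff (n - 1) = -a ∧ f.coeff 0 = (-1) ^ n * b} := by
    obtain ⟨x, hx⟩ := card_ne_zero.1 h
    obtain ⟨hd, rfl, rfl⟩ := (mem_filter.1 hx).2
    subst h3
    simpa [pow_succ] using two_le_card_irreducible_of_not_generator hq hK hd ha
  have hquad (h2 : n = 2) : Nat.card {f : F[X] // f.Monic ∧ Irreducible f ∧ f.natDegree = n ∧
      f.coeff (n - 1) = -a ∧ f.coeff 0 = (-1) ^ n * b} ≤ 1 := by
    subst h2
    exact card_irreducible_quadratic_le_one _ _
  rw [hK] at *
  set P := Nat.card {f : F[X] // f.Monic ∧ Irreducible f ∧ f.natDegree = n ∧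
      f.coeff (n - 1) = -a ∧ f.coeff 0 = (-1) ^ n * b}
  set D := #{x : K | (minpoly F x).natDegree ≠ n ∧
    Algebra.trace F K x = a ∧ Algebra.norm F x = b}
  change n * P + D = _ at hsplit
  rw [← hsplit] at hgauss
  push_cast at hgauss
  have hq1 : 1 < Fintype.card F := Fintype.one_lt_card
  have hdle : n.gcd (Fintype.card F - 1) ≤ Fintype.card F - 1 := Nat.gcd_le_right _ (by lia)
  have hdn : n.gcd (Fintype.card F - 1) ≤ n := Nat.gcd_le_left _ (by lia)
  have hd1 : 1 ≤ n.gcd (Fintype.card F - 1) := Nat.gcd_pos_of_pos_left _ (by lia)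
  set d := n.gcd (Fintype.card F - 1)
  set q := Fintype.card F
  have hdle' : (d : ℝ) ≤ q - 1 := by
    rw [le_sub_iff_add_le]; exact_mod_cast (by lia : d + 1 ≤ q)
  have hq1' : (2 : ℝ) ≤ q := by exact_mod_cast hq1
  have hd1' : (1 : ℝ) ≤ d := by exact_mod_cast hd1
  have hsq : √(q : ℝ) ^ 2 = q := Real.sq_sqrt (by positivity)
  have hs1 : 1 ≤ √(q : ℝ) := by rw [Real.one_le_sqrt]; linarith
  set s := √(q : ℝ)
  have hqq : 0 ≤ (q : ℝ) * (q - 1) := by nlinarith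
  have hw' : 0 ≤ (n : ℝ) ^ 2 / 2 * w * (q * (q - 1)) := by positivity
  have hsn (k : ℕ) : 1 ≤ s ^ k := one_le_pow₀ hs1
  have hns : 0 ≤ (n : ℝ) * (s ^ n - 1) := mul_nonneg (Nat.cast_nonneg n) (sub_nonneg.2 (hsn n))
  rw [abs_le] at hgauss ⊢
  obtain ⟨hlow, hupp⟩ := hgauss
  have hD : 0 ≤ (D : ℝ) * (q * (q - 1)) := mul_nonneg (Nat.cast_nonneg D) hqq
  obtain rfl | rfl | h4 : n = 2 ∨ n = 3 ∨ 4 ≤ n := by lia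
  · have h1 : (P : ℝ) ≤ 1 := by exact_mod_cast hquad rfl
    have h0 : (0 : ℝ) ≤ P := Nat.cast_nonneg P
    have h2 : 0 ≤ (q - 1 - d : ℝ) * (s - 1) * q :=
      mul_nonneg (mul_nonneg (by linarith) (by linarith)) (by linarith)
    have h3 : s ^ (2 + 1) = q * s := by rw [pow_succ, hsq]
    rw [h3, hsq]
    rw [hsq] at hns
    push_cast at hns hw' ⊢
    constructor
    · nlinarith [mul_nonneg h0 hqq]
    · nlinarith [mul_le_mul_of_nonneg_right h1 hqq]
  · have hs3 : s ^ 3 = q * s := by rw [pow_succ, hsq]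
    have hs4 : s ^ (3 + 1) = q ^ 2 := by rw [← hsq]; ring
    refine ⟨?_, by push_cast at hupp hns hw' ⊢; linarith⟩
    rcases Nat.le_one_iff_eq_zero_or_eq_one.1 (hcubic rfl) with hD0 | hD1
    · rw [hD0] at hlow
      push_cast at hlow hns hw' ⊢
      linarith
    rcases le_or_gt q 5 with hq5 | hq6
    · have hw9 : 2 / 9 ≤ w := hw3 rfl hq5
      have := mul_le_mul_of_nonneg_right hw9 hqq
      rw [hD1] at hlow
      push_cast at hlow hns hw' ⊢
      linarith
    · have h2 : (2 : ℝ) ≤ P := by exact_mod_cast htwo hq6 rfl (by lia)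
      have hq6' : (6 : ℝ) ≤ q := by exact_mod_cast hq6
      have h3 := mul_le_mul_of_nonneg_right h2 hqq
      have hd3 : (d : ℝ) ≤ 3 := by exact_mod_cast hdn
      have h5 := mul_nonneg (sub_nonneg.2 hd3) (sq_nonneg (q : ℝ))
      have h6 := mul_nonneg (sub_nonneg.2 hd1') (zero_le_one.trans (hsn 3))
      have h7 : (6 : ℝ) * q ≤ q ^ 2 := by nlinarith
      rw [hs4]
      push_cast at hw' ⊢
      linarith [hsn 3]
  · have hD' := mul_le_mul_of_nonneg_right (hlarge h4) hqq
    have hpow : s ^ (n - 4) * (q * (q - 1)) ≤ s ^ n - 1 := by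
      have h1 : s ^ (n - 4) * (q * (q - 1)) = s ^ n - s ^ (n - 2) := by
        obtain ⟨k, rfl⟩ := Nat.exists_eq_add_of_le' h4
        rw [← hsq, Nat.add_sub_cancel, Nat.add_sub_assoc (by norm_num)]
        ring
      rw [h1]
      linarith [hsn (n - 2)]
    have hpow' := mul_le_mul_of_nonneg_left hpow (Nat.cast_nonneg (α := ℝ) n)
    constructor <;> linarith

end Estimate

/-- bound for the number `P_n(a,b)` of monic irreducible
polynomials of degree `n` over `F_q` with prescribed `T^(n-1)`-coefficient `-a`
and constant coefficient `(-1)^n b`. -/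
theorem stmt14 (q n : ℕ) (hq : IsPrimePow q) (hn : 2 ≤ n)
    (Fq : Type) [Field Fq] [Fintype Fq] (hcard : Fintype.card Fq = q)
    (a b : Fq) (ha : a ≠ 0) (hb : b ≠ 0)
    (d : ℕ) (hd : d = Nat.gcd n (q - 1))
    (P : ℕ)
    (hP : P = Nat.card {f : Polynomial Fq // f.Monic ∧ Irreducible f ∧ f.natDegree = n ∧
        f.coeff (n - 1) = -a ∧ f.coeff 0 = (-1) ^ n * b}) :
    |(P : ℝ) - ((q : ℝ) ^ n - 1) / ((n : ℝ) * (q : ℝ) * ((q : ℝ) - 1))|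
      ≤ (1 / (n : ℝ)) *
          ((1 + ((q : ℝ) - 2) * (q : ℝ) ^ (((n : ℝ) - 1) / 2)
              - (q : ℝ) ^ (((n : ℝ) - 2) / 2) * ((q : ℝ) ^ ((1 : ℝ) / 2) - 1) * ((d : ℝ) - 1))
            / ((q : ℝ) - 1)
           + 1 / (q : ℝ))
        + ((q : ℝ) ^ ((n : ℝ) / 2) - 1) / ((q : ℝ) * ((q : ℝ) - 1))
        + ((n : ℝ) / 2) * (q : ℝ) ^ (((n : ℝ) - 4) / 4) := by
  obtain ⟨p, hchar⟩ := CharP.exists Fq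
  have : Fact p.Prime := ⟨CharP.char_is_prime Fq p⟩
  have : NeZero n := ⟨by lia⟩
  have : Fintype (FiniteField.Extension Fq p n) := Fintype.ofFinite _
  have hq2 : (2 : ℝ) ≤ q := by exact_mod_cast hq.two_le
  have hq0 : (0 : ℝ) ≤ q := by linarith
  have hrpow (x : ℝ) (k : ℕ) (hx : x = k / 2) : (q : ℝ) ^ x = √(q : ℝ) ^ k := by
    rw [Real.sqrt_eq_rpow, ← Real.rpow_natCast, ← Real.rpow_mul hq0, hx]
    ring_nf
  have h := abs_card_irreducible_sub_le hn (FiniteField.finrank_extension Fq p n) ha hb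
    (w := (q : ℝ) ^ (((n : ℝ) - 4) / 4)) (by positivity) (by
      rintro rfl hq5
      rw [hcard] at hq5
      refine le_of_pow_le_pow_left₀ four_ne_zero (by positivity) ?_
      have hq5' : (q : ℝ) ≤ 5 := by exact_mod_cast hq5
      rw [← Real.rpow_mul_natCast hq0]
      norm_num [Real.rpow_neg_one]
      refine le_trans ?_ (inv_anti₀ (by linarith) hq5')
      norm_num)
  rw [← hP, hcard, ← hd] at h
  rw [hrpow _ (n - 1) (by rw [Nat.cast_sub (by lia)]; simp),
    hrpow _ (n - 2) (by rw [Nat.cast_sub (by lia)]; simp), hrpow _ n rfl, hrpow _ 1 (by simp)]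
  have hsq : √(q : ℝ) ^ 2 = q := Real.sq_sqrt hq0
  obtain ⟨m, rfl⟩ := Nat.exists_eq_add_of_le' hn
  rw [Nat.add_sub_cancel, Nat.add_sub_assoc (by norm_num), pow_one]
  have hn0 : ((m + 2 : ℕ) : ℝ) ≠ 0 := by positivity
  have hq1 : (q : ℝ) - 1 ≠ 0 := by linarith
  have hpos : 0 < ((m + 2 : ℕ) : ℝ) * (q * (q - 1)) :=
    mul_pos (by positivity) (mul_pos (by linarith) (by linarith))
  rw [← mul_le_mul_iff_left₀ hpos]
  conv_lhs => rw [← abs_of_pos hpos, ← abs_mul]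
  have hq0' : (q : ℝ) ≠ 0 := by linarith
  generalize (q : ℝ) ^ (((m + 2 : ℕ) - 4 : ℝ) / 4) = w at *
  generalize ((m + 2 : ℕ) : ℝ) = N at *
  generalize √(q : ℝ) = s at *
  generalize (q : ℝ) = Q at *
  refine (Eq.le ?_).trans (h.trans (Eq.le ?_))
  · congr 1
    field_simp
  · subst hsq
    have hs0 : s ≠ 0 := pow_ne_zero_iff two_ne_zero |>.1 hq0'
    field_simp
    ring
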